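/- For n ≥ 1 let a_n = ∏_{i=1}^{n} q_i^(n+1−i), where q_i denotes the i-th prime (so a_1 = 2, a_2 = 2²·3, a_3 = 2³·3²·5, …). Let ℓ and p be distinct primes, and for each n let Per(n) be the number of elements of a finite field of order p^(a_n) that are periodic under the map x ↦ T_ℓ(x). Then, as n → ∞, Per(n)/p^(a_n) converges to 1/2 if ℓ is odd, and converges to 1/4 if ℓ = 2. -/

import Mathlib

open Polynomial Function

/-- The sequence a_n = ∏_{i=1}^{n} q_i^(n+1−i), where q_i is the i-th prime
(so a₁ = 2, a₂ = 2²·3, a₃ = 2³·3²·5, …). -/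
noncomputable def aSeq (n : ℕ) : ℕ :=
  ∏ i ∈ Finset.range n, (Nat.nth Nat.Prime i) ^ (n - i)

section Field

variable {K : Type*} [Field K]

theorem iterate_dickson_eval_add_inv (ℓ : ℕ) {z : K} (hz : z ≠ 0) (n : ℕ) :
    (fun x : K => (dickson 1 (1 : K) ℓ).eval x)^[n] (z + z⁻¹) =
      z ^ ℓ ^ n + (z ^ ℓ ^ n)⁻¹ := by
  induction n with
  | zero => simp
  | succ n ih =>
    rw [iterate_succ_apply', ih]
    rw [dickson_one_one_eval_add_inv _ _ (mul_inv_cancel₀ (pow_ne_zero _ hz)), inv_pow,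
      ← pow_mul, ← pow_succ]

theorem add_inv_eq_add_inv_iff {z w : K} (hz : z ≠ 0) (hw : w ≠ 0) :
    z + z⁻¹ = w + w⁻¹ ↔ z = w ∨ z = w⁻¹ := by
  constructor
  · intro h
    have h1 : (z - w) * (z * w - 1) = 0 := by
      field_simp at h
      linear_combination h
    rcases mul_eq_zero.1 h1 with h | h
    · exact Or.inl (sub_eq_zero.1 h)
    · exact Or.inr (eq_inv_of_mul_eq_one_left (sub_eq_zero.1 h))
  · rintro (rfl | rfl)
    · rfl
    · rw [inv_inv, add_comm]

theorem add_inv_mem_periodicPts_dickson_iff {ℓ : ℕ} (hℓ : ℓ.Prime) {z : K} (hz : z ≠ 0) :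
    z + z⁻¹ ∈ periodicPts (fun x : K => (dickson 1 (1 : K) ℓ).eval x) ↔
      (orderOf z).Coprime ℓ := by
  constructor
  · rintro ⟨n, hn, h⟩
    rw [IsPeriodicPt, IsFixedPt, iterate_dickson_eval_add_inv ℓ hz,
      add_inv_eq_add_inv_iff (pow_ne_zero _ hz) hz] at h
    rw [Nat.coprime_comm, hℓ.coprime_iff_not_dvd]
    intro hdvd
    have hpow : ℓ ∣ ℓ ^ n := dvd_pow_self _ hn.ne'
    rcases h with h | h
    · have h1 : z ^ (ℓ ^ n - 1) = 1 := by
        apply mul_right_cancel₀ hz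
        rw [← pow_succ, Nat.sub_add_cancel (Nat.one_le_pow _ _ hℓ.pos), h, one_mul]
      have h2 := hdvd.trans (orderOf_dvd_of_pow_eq_one h1)
      have h3 := (Nat.dvd_sub_iff_right (Nat.one_le_pow _ _ hℓ.pos) hpow).1 h2
      exact hℓ.one_lt.ne' (Nat.dvd_one.1 h3)
    · have h1 : z ^ (ℓ ^ n + 1) = 1 := by
        rw [pow_succ, h, inv_mul_cancel₀ hz]
      have h2 := hdvd.trans (orderOf_dvd_of_pow_eq_one h1)
      exact hℓ.one_lt.ne' (Nat.dvd_one.1 ((Nat.dvd_add_right hpow).1 h2))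
  · intro h
    have hpos : 0 < orderOf z := by
      rw [Nat.pos_iff_ne_zero]
      intro h0
      rw [h0, Nat.coprime_zero_left] at h
      exact hℓ.one_lt.ne' h
    refine ⟨(orderOf z).totient, Nat.totient_pos.2 hpos, ?_⟩
    rw [IsPeriodicPt, IsFixedPt, iterate_dickson_eval_add_inv ℓ hz]
    have h1 : ℓ ^ (orderOf z).totient % orderOf z = 1 % orderOf z :=
      Nat.ModEq.pow_totient h.symm
    rw [← pow_mod_orderOf z (ℓ ^ _), h1, pow_mod_orderOf, pow_one]

theorem exists_add_inv_eq [IsAlgClosed K] (x : K) : ∃ z : K, z ≠ 0 ∧ z + z⁻¹ = x := by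
  have hdeg : (X ^ 2 - C x * X + 1 : K[X]).degree = 2 := by
    compute_degree!
  obtain ⟨z, hz⟩ := IsAlgClosed.exists_root (X ^ 2 - C x * X + 1 : K[X]) (by simp [hdeg])
  simp only [IsRoot.def, eval_add, eval_sub, eval_pow, eval_X, eval_mul, eval_C, eval_one] at hz
  have h0 : z ≠ 0 := by
    rintro rfl
    simp at hz
  refine ⟨z, h0, ?_⟩
  field_simp
  linear_combination hz

open Finset Classical in
theorem card_nthRootsFinset_le_two_mul_card_image_add_inv (m : ℕ) :
    #(nthRootsFinset m (1 : K)) ≤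
      2 * #((nthRootsFinset m (1 : K)).image fun z => z + z⁻¹) := by
  have hne : ∀ z ∈ nthRootsFinset m (1 : K), z ≠ 0 := fun z hz =>
    ne_zero_of_mem_nthRootsFinset one_ne_zero hz
  refine card_le_mul_card_image _ _ fun b hb => ?_
  obtain ⟨z, hz, rfl⟩ := mem_image.1 hb
  refine (card_le_card (t := {z, z⁻¹}) fun w hw => ?_).trans card_le_two
  rw [mem_filter] at hw
  simpa using (add_inv_eq_add_inv_iff (hne w hw.1) (hne z hz)).1 hw.2

open Finset Classical in
theorem two_mul_card_image_add_inv_le_card_nthRootsFinset_add_four (m : ℕ) (hm : 0 < m) :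
    2 * #((nthRootsFinset m (1 : K)).image fun z => z + z⁻¹) ≤
      #(nthRootsFinset m (1 : K)) + 4 := by
  set S := nthRootsFinset m (1 : K)
  have hinv : ∀ z ∈ S, z⁻¹ ∈ S := fun z hz => by
    rw [mem_nthRootsFinset hm] at hz ⊢
    rw [inv_pow, hz, inv_one]
  set T := S.filter fun z => z ≠ z⁻¹
  have hT : 2 * #(T.image fun z => z + z⁻¹) ≤ #T := by
    refine mul_card_image_le_card _ _ fun b hb => ?_
    obtain ⟨z, hz, rfl⟩ := mem_image.1 hb
    rw [mem_filter] at hz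
    rw [← card_pair hz.2]
    refine card_le_card fun w hw => ?_
    rw [mem_insert, mem_singleton] at hw
    rcases hw with rfl | rfl
    · simp [T, hz]
    · simp [T, hinv z hz.1, add_comm, Ne.symm hz.2]
  have hsub : (S.image fun z => z + z⁻¹) ⊆ (T.image fun z => z + z⁻¹) ∪ {2, -2} := by
    intro b hb
    obtain ⟨z, hz, rfl⟩ := mem_image.1 hb
    rw [mem_union]
    by_cases h : z = z⁻¹
    · right
      have h0 : z ≠ 0 := ne_zero_of_mem_nthRootsFinset one_ne_zero hz
      have h1 : z * z = 1 := by
        nth_rewrite 2 [h]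
        exact mul_inv_cancel₀ h0
      rw [← h, mem_insert, mem_singleton]
      rcases mul_self_eq_one_iff.1 h1 with rfl | rfl
      · left; norm_num
      · right; norm_num
    · exact Or.inl (mem_image_of_mem _ (mem_filter.2 ⟨hz, h⟩))
  have h1 := (card_le_card hsub).trans (card_union_le _ _)
  have h2 : #({2, -2} : Finset K) ≤ 2 := card_le_two
  have h3 : #T ≤ #S := card_filter_le _ _
  omega

end Field

section FiniteField

variable {F K : Type*} [Field F] [Field K] [Algebra F K]

theorem algebraMap_mem_periodicPts_dickson_iff (ℓ : ℕ) (a : F) :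
    algebraMap F K a ∈ periodicPts (fun x : K => (dickson 1 (1 : K) ℓ).eval x) ↔
      a ∈ periodicPts (fun x : F => (dickson 1 (1 : F) ℓ).eval x) := by
  have hsemi : Semiconj (algebraMap F K) (fun x : F => (dickson 1 (1 : F) ℓ).eval x)
      (fun x : K => (dickson 1 (1 : K) ℓ).eval x) := fun x => by
    beta_reduce
    rw [← map_one (algebraMap F K), ← map_dickson, eval_map_algebraMap, aeval_algebraMap_apply,
      coe_aeval_eq_eval]
  simp only [periodicPts, Set.mem_ofPred_eq, IsPeriodicPt, IsFixedPt]
  refine exists_congr fun n => and_congr_right fun _ => ?_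
  rw [← (hsemi.iterate_right n).eq, (algebraMap F K).injective.eq_iff]

variable [Fintype F]

theorem exists_algebraMap_eq_of_pow_card_eq {x : K} (hx : x ^ Fintype.card F = x) :
    ∃ y : F, algebraMap F K y = x := by
  have hne : (X ^ Fintype.card F - X : F[X]) ≠ 0 :=
    FiniteField.X_pow_card_sub_X_ne_zero F Fintype.one_lt_card
  have hsplits : (X ^ Fintype.card F - X : F[X]).Splits := by
    rw [splits_iff_card_roots, FiniteField.roots_X_pow_card_sub_X,
      FiniteField.X_pow_card_sub_X_natDegree_eq F Fintype.one_lt_card]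
    rfl
  exact hsplits.mem_range_of_isRoot hne (by simp [hx])

theorem add_inv_pow_card {z : K} : (z + z⁻¹) ^ Fintype.card F =
    z ^ Fintype.card F + (z ^ Fintype.card F)⁻¹ := by
  rw [← inv_pow]
  exact map_add (FiniteField.frobeniusAlgHom F K) z z⁻¹

theorem exists_algebraMap_eq_add_inv_iff {z : K} (hz : z ≠ 0) :
    (∃ a : F, algebraMap F K a = z + z⁻¹) ↔
      z ^ (Fintype.card F - 1) = 1 ∨ z ^ (Fintype.card F + 1) = 1 := by
  have h1 : (∃ a : F, algebraMap F K a = z + z⁻¹) ↔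
      (z + z⁻¹) ^ Fintype.card F = z + z⁻¹ := by
    refine ⟨?_, exists_algebraMap_eq_of_pow_card_eq⟩
    rintro ⟨a, ha⟩
    rw [← ha, ← map_pow, FiniteField.pow_card]
  rw [h1, add_inv_pow_card, add_inv_eq_add_inv_iff (pow_ne_zero _ hz) hz]
  refine or_congr ?_ ?_
  · rw [← mul_left_inj' hz (b := 1), ← pow_succ,
      Nat.sub_add_cancel Fintype.card_pos, one_mul]
  · rw [pow_succ, ← mul_eq_one_iff_eq_inv₀ hz]

theorem natCast_ne_zero_of_mul_eq_card_add_one {c m : ℕ} (hcm : c * m = Fintype.card F + 1) :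
    (m : K) ≠ 0 := by
  intro h
  have h1 : ((c * m : ℕ) : K) = ((Fintype.card F + 1 : ℕ) : K) := by rw [hcm]
  have h2 : ((Fintype.card F : ℕ) : K) = 0 := by
    rw [← map_natCast (algebraMap F K), FiniteField.cast_card_eq_zero, map_zero]
  push_cast at h1
  simp [h, h2] at h1

open Finset in
theorem card_periodicPts_dickson_bounds {ℓ : ℕ} (hℓ : ℓ.Prime) {c m d s : ℕ}
    (hcm : c * m = Fintype.card F + 1) (hc : c ∣ ℓ) (hm : m.Coprime ℓ)
    (hds : ℓ ^ d * s = Fintype.card F - 1) :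
    m ≤ 2 * {a : F | a ∈ periodicPts (fun x : F => (dickson 1 (1 : F) ℓ).eval x)}.ncard ∧
      2 * {a : F | a ∈ periodicPts (fun x : F => (dickson 1 (1 : F) ℓ).eval x)}.ncard ≤
        m + 4 + 2 * s := by
  classical
  set P := {a : F | a ∈ periodicPts (fun x : F => (dickson 1 (1 : F) ℓ).eval x)} with hP
  let L := AlgebraicClosure F
  have hinj : Injective (algebraMap F L) := (algebraMap F L).injective
  have hm0 : 0 < m := Nat.pos_of_ne_zero (by rintro rfl; simp at hcm)
  have hs0 : 0 < s := Nat.pos_of_ne_zero (by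
    rintro rfl
    have := Fintype.one_lt_card (α := F)
    omega)
  have : NeZero (m : L) := ⟨natCast_ne_zero_of_mul_eq_card_add_one hcm⟩
  obtain ⟨ζ, hζ⟩ := HasEnoughRootsOfUnity.exists_primitiveRoot L m
  have h3 := card_nthRootsFinset_le_two_mul_card_image_add_inv (K := L) m
  have h4 := two_mul_card_image_add_inv_le_card_nthRootsFinset_add_four (K := L) m hm0
  rw [hζ.card_nthRootsFinset] at h3 h4
  have hB : #((nthRootsFinset s (1 : L)).image fun z => z + z⁻¹) ≤ s := card_image_le.trans
    ((Multiset.toFinset_card_le _).trans (card_nthRoots s (1 : L)))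
  generalize hA' : ((nthRootsFinset m (1 : L)).image fun z => z + z⁻¹) = A at h3 h4
  generalize hB' : ((nthRootsFinset s (1 : L)).image fun z => z + z⁻¹) = B at hB
  have hlow : (A : Set L) ⊆ algebraMap F L '' P := by
    intro y hy
    rw [mem_coe, ← hA'] at hy
    obtain ⟨z, hz, rfl⟩ := mem_image.1 hy
    have hz0 : z ≠ 0 := ne_zero_of_mem_nthRootsFinset one_ne_zero hz
    rw [mem_nthRootsFinset hm0] at hz
    obtain ⟨a, ha⟩ := (exists_algebraMap_eq_add_inv_iff (F := F) hz0).2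
      (Or.inr (by rw [← hcm, mul_comm, pow_mul, hz, one_pow]))
    refine ⟨a, ?_, ha⟩
    rw [hP, Set.mem_ofPred_eq, ← algebraMap_mem_periodicPts_dickson_iff (K := L), ha,
      add_inv_mem_periodicPts_dickson_iff hℓ hz0]
    exact Nat.Coprime.coprime_dvd_left (orderOf_dvd_of_pow_eq_one hz) hm
  have hupp : algebraMap F L '' P ⊆ ((A ∪ B : Finset L) : Set L) := by
    rintro _ ⟨a, ha, rfl⟩
    obtain ⟨z, hz0, hz⟩ := exists_add_inv_eq (algebraMap F L a)
    rw [hP, Set.mem_ofPred_eq, ← algebraMap_mem_periodicPts_dickson_iff (K := L), ← hz,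
      add_inv_mem_periodicPts_dickson_iff hℓ hz0] at ha
    rw [← hz, mem_coe, mem_union, ← hA', ← hB']
    rcases (exists_algebraMap_eq_add_inv_iff (F := F) hz0).1 ⟨a, hz.symm⟩ with h | h
    · right
      refine mem_image_of_mem (fun z => z + z⁻¹) ((mem_nthRootsFinset hs0 _).2 ?_)
      rw [← hds] at h
      exact orderOf_dvd_iff_pow_eq_one.1
        ((ha.pow_right d).dvd_of_dvd_mul_left (orderOf_dvd_of_pow_eq_one h))
    · left
      refine mem_image_of_mem (fun z => z + z⁻¹) ((mem_nthRootsFinset hm0 _).2 ?_)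
      rw [← hcm] at h
      exact orderOf_dvd_iff_pow_eq_one.1
        ((ha.coprime_dvd_right hc).dvd_of_dvd_mul_left (orderOf_dvd_of_pow_eq_one h))
  have h1 := Set.ncard_le_ncard hlow (Set.toFinite _)
  have h2 := Set.ncard_le_ncard hupp (Finset.finite_toSet _)
  rw [Set.ncard_image_of_injective _ hinj, Set.ncard_coe_finset] at h1 h2
  have h6 := card_union_le A B
  omega

end FiniteField

theorem eventually_dvd_aSeq {d : ℕ} (hd : d ≠ 0) : ∀ᶠ n in Filter.atTop, d ∣ aSeq n := by
  induction d using Nat.recOnPrimeCoprime with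
  | zero => exact absurd rfl hd
  | prime_pow r e hr =>
    filter_upwards [Filter.eventually_gt_atTop (Nat.count Nat.Prime r + e)] with n hn
    have h1 : r ^ e ∣ Nat.nth Nat.Prime (Nat.count Nat.Prime r) ^
        (n - Nat.count Nat.Prime r) := by
      rw [Nat.nth_count hr]
      exact pow_dvd_pow r (by omega)
    exact h1.trans (Finset.dvd_prod_of_mem (fun i => Nat.nth Nat.Prime i ^ (n - i))
      (Finset.mem_range.2 (by omega)))
  | coprime a b ha hb hab iha ihb =>
    filter_upwards [iha (by omega), ihb (by omega)] with n h1 h2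
    exact hab.mul_dvd_of_dvd_of_dvd h1 h2

theorem eventually_dvd_pow_aSeq_sub_one {N p : ℕ} (hN : N ≠ 0) (hp : p.Coprime N) :
    ∀ᶠ n in Filter.atTop, N ∣ p ^ aSeq n - 1 := by
  filter_upwards [eventually_dvd_aSeq (Nat.totient_pos.2 (Nat.pos_of_ne_zero hN)).ne']
    with n ⟨t, ht⟩
  have h1 : p ^ aSeq n ≡ 1 [MOD N] := by
    rw [ht, pow_mul]
    simpa using (Nat.ModEq.pow_totient hp).pow t
  rcases Nat.eq_zero_or_pos (p ^ aSeq n) with h0 | h0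
  · simp [h0]
  · exact (Nat.modEq_iff_dvd' h0).1 h1.symm

theorem aSeq_ne_zero (n : ℕ) : aSeq n ≠ 0 :=
  Finset.prod_ne_zero_iff.2 fun i _ => pow_ne_zero _ (Nat.prime_nth_prime i).ne_zero

theorem tendsto_card_periodicPts_dickson_div {ℓ p : ℕ} (hℓ : ℓ.Prime) [hp : Fact p.Prime]
    (hℓp : ℓ ≠ p) {c : ℕ} (hc : c ∣ ℓ)
    (hcm : ∀ᶠ n in Filter.atTop, ∃ m : ℕ, c * m = p ^ aSeq n + 1 ∧ m.Coprime ℓ) :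
    Filter.Tendsto
      (fun n : ℕ =>
        (({a : GaloisField p (aSeq n) |
            a ∈ periodicPts
              (fun x : GaloisField p (aSeq n) =>
                (dickson 1 (1 : GaloisField p (aSeq n)) ℓ).eval x)}.ncard : ℝ)
          / (p : ℝ) ^ (aSeq n)))
      Filter.atTop (nhds (1 / (2 * c))) := by
  rw [Metric.tendsto_nhds]
  intro ε hε
  have hℓ1 : (1 : ℝ) < ℓ := by exact_mod_cast hℓ.one_lt
  obtain ⟨d, hd⟩ := pow_unbounded_of_one_lt (4 / ε) hℓ1
  have hcop : p.Coprime (ℓ ^ d) := ((Nat.coprime_primes hp.out hℓ).2 hℓp.symm).pow_right d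
  filter_upwards [hcm, eventually_dvd_pow_aSeq_sub_one (pow_ne_zero d hℓ.ne_zero) hcop]
    with n ⟨m, hm, hmℓ⟩ ⟨s, hs⟩
  have := Fintype.ofFinite (GaloisField p (aSeq n))
  have hcard : Fintype.card (GaloisField p (aSeq n)) = p ^ aSeq n := by
    rw [← Nat.card_eq_fintype_card, GaloisField.card p _ (aSeq_ne_zero n)]
  obtain ⟨h1, h2⟩ := card_periodicPts_dickson_bounds (F := GaloisField p (aSeq n)) hℓ
    (hm.trans (by rw [hcard])) hc hmℓ (hs.symm.trans (by rw [hcard]))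
  generalize {a : GaloisField p (aSeq n) | a ∈ periodicPts
    (fun x => (dickson 1 (1 : GaloisField p (aSeq n)) ℓ).eval x)}.ncard = N at h1 h2 ⊢
  have hq1 : 1 < p ^ aSeq n := Nat.one_lt_pow (aSeq_ne_zero n) hp.out.one_lt
  have hs' : ℓ ^ d * s + 1 = p ^ aSeq n := by omega
  have hs1 : 1 ≤ s := Nat.pos_of_ne_zero (by rintro rfl; omega)
  have hc1 : 1 ≤ c := Nat.pos_of_dvd_of_pos hc hℓ.pos
  rw [← Nat.cast_pow p]
  generalize p ^ aSeq n = q at hm hq1 hs'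
  have hmR : (c : ℝ) * m = q + 1 := by exact_mod_cast hm
  have hsR : (ℓ : ℝ) ^ d * s + 1 = q := by exact_mod_cast hs'
  have h1R : (m : ℝ) ≤ 2 * N := by exact_mod_cast h1
  have h2R : 2 * (N : ℝ) ≤ m + 4 + 2 * s := by exact_mod_cast h2
  have hs1R : (1 : ℝ) ≤ s := by exact_mod_cast hs1
  have hc1R : (1 : ℝ) ≤ c := by exact_mod_cast hc1
  have hq0 : (0 : ℝ) < q := by exact_mod_cast hq1.trans' one_pos
  have hℓd : (0 : ℝ) < (ℓ : ℝ) ^ d := by positivity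
  generalize (ℓ : ℝ) ^ d = M at hd hsR hℓd
  have ht0 : (0 : ℝ) < 1 / c := by positivity
  have ht1 : 1 / (c : ℝ) ≤ 1 := (div_le_one (by positivity)).2 hc1R
  have hmt : (m : ℝ) = (q + 1) * (1 / c) := by
    rw [← hmR]
    field_simp
  have hsplit : (N : ℝ) / q - 1 / (2 * c) = (2 * N - m + 1 / c) / (2 * q) := by
    rw [hmt]
    field_simp
    ring
  have hMs : M ≤ M * s := le_mul_of_one_le_right hℓd.le hs1R
  have hεM : 4 < ε * M := by rwa [div_lt_iff₀' hε] at hd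
  have hbound : (5 + 2 * s) < ε * (2 * q) := by
    have h5 : (5 + 2 * s) * M < ε * (2 * q) * M := by nlinarith
    exact lt_of_mul_lt_mul_right h5 hℓd.le
  rw [Real.dist_eq, hsplit, abs_of_nonneg (by
    apply div_nonneg <;> linarith), div_lt_iff₀ (by positivity)]
  linarith

/-- Let ℓ ≠ p be primes and, for each n, let Per(n) be the number of
elements of a finite field of order p^(a_n) that are periodic under x ↦ T_ℓ(x).  Then
Per(n)/p^(a_n) → 1/2 as n → ∞ if ℓ is odd, and Per(n)/p^(a_n) → 1/4 if ℓ = 2. -/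
theorem chebyshev_periodic_density
    (ℓ p : ℕ) (hℓ : ℓ.Prime) [hp : Fact p.Prime] (hℓp : ℓ ≠ p) :
    (Odd ℓ →
      Filter.Tendsto
        (fun n : ℕ =>
          (({a : GaloisField p (aSeq n) |
              a ∈ periodicPts
                (fun x : GaloisField p (aSeq n) =>
                  (dickson 1 (1 : GaloisField p (aSeq n)) ℓ).eval x)}.ncard : ℝ)
            / (p : ℝ) ^ (aSeq n)))
        Filter.atTop (nhds (1 / 2))) ∧
    (ℓ = 2 →
      Filter.Tendsto
        (fun n : ℕ =>
          (({a : GaloisField p (aSeq n) |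
              a ∈ periodicPts
                (fun x : GaloisField p (aSeq n) =>
                  (dickson 1 (1 : GaloisField p (aSeq n)) ℓ).eval x)}.ncard : ℝ)
            / (p : ℝ) ^ (aSeq n)))
        Filter.atTop (nhds (1 / 4))) := by
  have hcop : p.Coprime ℓ := (Nat.coprime_primes hp.out hℓ).2 hℓp.symm
  have hpos : ∀ n, 0 < p ^ aSeq n := fun n => pow_pos hp.out.pos _
  constructor
  · intro hodd
    have h := tendsto_card_periodicPts_dickson_div hℓ hℓp (one_dvd ℓ) (by
      filter_upwards [eventually_dvd_pow_aSeq_sub_one hℓ.ne_zero hcop] with n hn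
      refine ⟨p ^ aSeq n + 1, one_mul _, ?_⟩
      rw [Nat.coprime_comm, hℓ.coprime_iff_not_dvd]
      intro h
      have h2 : ℓ ∣ 2 := by
        have := hpos n
        convert Nat.dvd_sub h hn using 1
        omega
      rw [(Nat.prime_dvd_prime_iff_eq hℓ Nat.prime_two).1 h2] at hodd
      exact absurd hodd (by decide))
    simpa using h
  · rintro rfl
    have h := tendsto_card_periodicPts_dickson_div hℓ hℓp (dvd_refl 2) (by
      filter_upwards [eventually_dvd_pow_aSeq_sub_one (N := 2 ^ 2) (by norm_num)
        (hcop.pow_right 2)] with n hn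
      have := hpos n
      refine ⟨(p ^ aSeq n + 1) / 2, by omega, ?_⟩
      rw [Nat.coprime_two_right, Nat.odd_iff]
      omega)
    convert h using 2
    norm_num
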